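/- Lower bound on the modulation scale from the mass: for every M > 0 there exist δ₀ > 0 and C > 0 such that the following holds. Let f : ℝ³ → ℂ be radial, continuously differentiable, with f ∈ L²(ℝ³) ∩ L⁴(ℝ³) ∩ L⁶(ℝ³), ∇f ∈ L²(ℝ³), and ‖f‖_{L²} ≤ M; let θ ∈ ℝ and μ > 0, and set g := e^{−iθ} f − μ^{1/2} W(μ·). Assume E(f) = E^c(W), ‖∇g‖_{L²} ≤ δ₀, and the orthogonality conditions ∫_{ℝ³} ∇(Im g)·∇( μ^{1/2} W(μ·) ) dx = 0 and ∫_{ℝ³} ∇(Re g)·∇( μ^{1/2} W₁(μ·) ) dx = 0. Then 1/(1 + μ) ≤ C δ(f), where δ(f) := |‖∇W‖_{L²}² − ‖∇f‖_{L²}²|. -/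

import Mathlib

open MeasureTheory Complex
open scoped BigOperators ENNReal

noncomputable section

abbrev E3 := EuclideanSpace ℝ (Fin 3)

/-- The Aubin–Talenti ground state `W(x) = (1 + |x|²/3)^(-1/2)`. -/
def W (x : E3) : ℝ := (1 + ‖x‖ ^ 2 / 3) ^ (-(1 : ℝ) / 2)

/-- `W` viewed as a complex-valued function. -/
def Wc (x : E3) : ℂ := (W x : ℂ)

/-- Standard basis vectors of ℝ³. -/
def e3 (i : Fin 3) : E3 := EuclideanSpace.single i 1

/-- Partial derivative of a real-valued function. -/
def pdR (i : Fin 3) (f : E3 → ℝ) (x : E3) : ℝ := fderiv ℝ f x (e3 i)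

/-- Partial derivative of a complex-valued function. -/
def pdC (i : Fin 3) (f : E3 → ℂ) (x : E3) : ℂ := fderiv ℝ f x (e3 i)

/-- Squared gradient `|∇f|²` of a real-valued function. -/
def gradSqR (f : E3 → ℝ) (x : E3) : ℝ := ∑ i, (pdR i f x) ^ 2

/-- Squared gradient `|∇f|²` of a complex-valued function. -/
def gradSqC (f : E3 → ℂ) (x : E3) : ℝ := ∑ i, ‖pdC i f x‖ ^ 2

/-- Laplacian of a real-valued function. -/
def lapR (f : E3 → ℝ) (x : E3) : ℝ := ∑ i, pdR i (pdR i f) x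

/-- Laplacian of a complex-valued function. -/
def lapC (f : E3 → ℂ) (x : E3) : ℂ := ∑ i, pdC i (pdC i f) x

/-- Quintic (energy-critical) energy `E^c`. -/
def Ecrit (f : E3 → ℂ) : ℝ := ∫ x : E3, ((1:ℝ)/2 * gradSqC f x - 1/6 * ‖f x‖ ^ 6)

/-- Cubic–quintic energy `E`. -/
def Ecq (f : E3 → ℂ) : ℝ :=
  ∫ x : E3, ((1:ℝ)/2 * gradSqC f x - 1/6 * ‖f x‖ ^ 6 + 1/4 * ‖f x‖ ^ 4)

/-- Regular solutions of the cubic–quintic NLS on an interval `I ⊆ ℝ`. -/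
def IsRegularSolution (I : Set ℝ) (u : ℝ → E3 → ℂ) : Prop :=
  ContDiffOn ℝ (⊤ : ℕ∞) (fun p : ℝ × E3 => u p.1 p.2) (I ×ˢ Set.univ) ∧
  (∀ t ∈ I, ∀ x : E3, Complex.I * deriv (fun s => u s x) t + lapC (u t) x =
      (‖u t x‖ : ℂ) ^ 2 * u t x - (‖u t x‖ : ℂ) ^ 4 * u t x) ∧
  (∀ J : Set ℝ, IsCompact J → J ⊆ I → ∀ n k : ℕ, ∃ C : ℝ, ∀ t ∈ J, ∀ x : E3,
      (1 + ‖x‖) ^ n * ‖iteratedFDeriv ℝ k (u t) x‖ ≤ C)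


/-- A function on ℝ³ is radial if it depends only on the norm. -/
def IsRadial {α : Type*} (f : E3 → α) : Prop := ∀ x y : E3, ‖x‖ = ‖y‖ → f x = f y

/-- `W₁ = ½W + x·∇W`. -/
def W1 (x : E3) : ℝ := (1:ℝ)/2 * W x + fderiv ℝ W x x

/-- The modulation remainder `g = e^{-iθ} f - μ^{1/2} W(μ·)`. -/
def modG (f : E3 → ℂ) (θ μ : ℝ) (x : E3) : ℂ :=
  Complex.exp (-θ * Complex.I) * f x - ((Real.sqrt μ * W (μ • x) : ℝ) : ℂ)

/-- `δ(f) = |‖∇W‖_{L²}² − ‖∇f‖_{L²}²|`. -/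
def deltaF (f : E3 → ℂ) : ℝ := |(∫ x : E3, gradSqR W x) - ∫ x : E3, gradSqC f x|

/-- The area under the quarter circle between `0` and `y`. -/
def circArea (y : ℝ) : ℝ := ∫ u in (0:ℝ)..y, √(1 - u ^ 2)

lemma hasDerivAt_circArea (y : ℝ) : HasDerivAt circArea (√(1 - y ^ 2)) y := by
  have hc : Continuous fun u : ℝ => √(1 - u ^ 2) := by fun_prop
  exact hc.integral_hasStrictDerivAt 0 y |>.hasDerivAt

lemma circArea_zero : circArea 0 = 0 := by simp [circArea]

lemma circArea_one : circArea 1 = Real.pi / 4 := by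
  have hc : Continuous fun u : ℝ => √(1 - u ^ 2) := by fun_prop
  have h := integral_sqrt_one_sub_sq
  rw [← intervalIntegral.integral_add_adjacent_intervals (b := 0)
    (hc.intervalIntegrable _ _) (hc.intervalIntegrable _ _)] at h
  have h2 : (∫ u in (-1:ℝ)..0, √(1 - u ^ 2)) = ∫ u in (0:ℝ)..1, √(1 - u ^ 2) := by
    have := intervalIntegral.integral_comp_neg (a := 0) (b := 1) fun u : ℝ => √(1 - u ^ 2)
    simpa using this.symm
  unfold circArea
  linarith

lemma circArea_le {y : ℝ} (hy : 0 ≤ y) : circArea y ≤ y := by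
  have hc : Continuous fun u : ℝ => √(1 - u ^ 2) := by fun_prop
  have := intervalIntegral.integral_mono_on hy (hc.intervalIntegrable (μ := volume) _ _)
    (continuous_const (y := (1:ℝ)).intervalIntegrable (μ := volume) _ _)
    (fun u _ => by
      exact Real.sqrt_le_iff.2 ⟨zero_le_one, by nlinarith [sq_nonneg u]⟩)
  simpa [circArea] using this

/-- Derivative of `r ↦ r ‖φ r‖²`. -/
def massDeriv (φ : ℝ → ℂ) (r : ℝ) : ℝ := ‖φ r‖ ^ 2 + r * (2 * inner ℝ (φ r) (deriv φ r))

lemma hasDerivAt_mul_norm_sq {φ : ℝ → ℂ} (hφ : ContDiff ℝ 1 φ) (r : ℝ) :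
    HasDerivAt (fun s => s * ‖φ s‖ ^ 2) (massDeriv φ r) r := by
  have h := (hφ.differentiable one_ne_zero r).hasDerivAt
  refine ((hasDerivAt_id r).mul h.norm_sq).congr_deriv ?_
  simp only [massDeriv, id, one_mul]

lemma continuous_massDeriv {φ : ℝ → ℂ} (hφ : ContDiff ℝ 1 φ) : Continuous (massDeriv φ) := by
  have := hφ.continuous
  have := hφ.continuous_deriv le_rfl
  unfold massDeriv
  fun_prop

/-- Completing the square in the Emden–Fowler form of the radial energy density. -/
lemma abs_massDeriv_le (φ : ℝ → ℂ) {r X : ℝ} (hr : 0 ≤ r) (hX : 0 < X)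
    (hp : r * ‖φ r‖ ^ 2 ≤ X) :
    |√(1 - (r * ‖φ r‖ ^ 2 / X) ^ 2) * massDeriv φ r| / 2 ≤
      r ^ 2 * ‖deriv φ r‖ ^ 2 + massDeriv φ r / 2 - r ^ 2 * ‖φ r‖ ^ 6 / (4 * X ^ 2) := by
  set z := φ r
  set d := deriv φ r
  set v : ℂ := (1 / 2 : ℝ) • z + r • d with hv
  have h0 : 0 ≤ r * ‖z‖ ^ 2 := by positivity
  have hle : (r * ‖z‖ ^ 2 / X) ^ 2 ≤ 1 := by
    rw [sq_le_one_iff₀ (by positivity), div_le_one hX]; exact hp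
  set s := √(1 - (r * ‖z‖ ^ 2 / X) ^ 2) with hs
  have hs2 : s ^ 2 = 1 - (r * ‖z‖ ^ 2 / X) ^ 2 := Real.sq_sqrt (by linarith)
  have hs0 : 0 ≤ s := Real.sqrt_nonneg _
  have hm : massDeriv φ r = 2 * inner ℝ z v := by
    simp only [massDeriv, hv, inner_add_right, real_inner_smul_right, real_inner_self_eq_norm_sq]
    ring
  have hn : ‖v‖ ^ 2 = ‖z‖ ^ 2 / 4 + r * inner ℝ z d + r ^ 2 * ‖d‖ ^ 2 := by
    rw [hv, norm_add_sq_real, norm_smul, norm_smul, real_inner_smul_left, real_inner_smul_right,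
      mul_pow, mul_pow, Real.norm_eq_abs, Real.norm_eq_abs, sq_abs, sq_abs]
    ring
  have hcs : |massDeriv φ r| ≤ 2 * (‖z‖ * ‖v‖) := by
    rw [hm, abs_mul, abs_two]
    exact mul_le_mul_of_nonneg_left (abs_real_inner_le_norm z v) two_pos.le
  have hrhs : r ^ 2 * ‖d‖ ^ 2 + massDeriv φ r / 2 - r ^ 2 * ‖z‖ ^ 6 / (4 * X ^ 2) =
      ‖v‖ ^ 2 + ‖z‖ ^ 2 / 4 * s ^ 2 := by
    rw [hn, hs2]; simp only [massDeriv]; field_simp; ring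
  rw [hrhs, abs_mul, abs_of_nonneg hs0]
  nlinarith [mul_le_mul_of_nonneg_left hcs hs0, sq_nonneg (‖v‖ - ‖z‖ / 2 * s)]

/-- Bogomolny-type lower bound for the radial Dirichlet energy on `[0, b]`. -/
lemma radial_energy_lower_bound {φ : ℝ → ℂ} (hφ : ContDiff ℝ 1 φ) {b X r₀ : ℝ} (hX : 0 < X)
    (hr₀ : r₀ ∈ Set.Icc 0 b) (hmax : ∀ r ∈ Set.Icc 0 b, r * ‖φ r‖ ^ 2 ≤ X)
    (hatt : r₀ * ‖φ r₀‖ ^ 2 = X) :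
    Real.pi / 4 * X + (∫ r in (0:ℝ)..b, r ^ 2 * ‖φ r‖ ^ 6) / (4 * X ^ 2) ≤
      (∫ r in (0:ℝ)..b, r ^ 2 * ‖deriv φ r‖ ^ 2) + b * ‖φ b‖ ^ 2 := by
  have hc := hφ.continuous
  have hcd := hφ.continuous_deriv le_rfl
  have hcm := continuous_massDeriv hφ
  set H : ℝ → ℝ := fun r => X * circArea (r * ‖φ r‖ ^ 2 / X) with hH
  set H' : ℝ → ℝ := fun r => √(1 - (r * ‖φ r‖ ^ 2 / X) ^ 2) * massDeriv φ r with hH'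
  have hd : ∀ r, HasDerivAt H (H' r) r := fun r => by
    have := ((hasDerivAt_circArea _).comp r
      ((hasDerivAt_mul_norm_sq hφ r).div_const X)).const_mul X
    refine this.congr_deriv ?_
    simp only [hH']; field_simp
  have hcH : Continuous H' := by simp only [hH']; fun_prop
  set G : ℝ → ℝ := fun r =>
    r ^ 2 * ‖deriv φ r‖ ^ 2 + massDeriv φ r / 2 - r ^ 2 * ‖φ r‖ ^ 6 / (4 * X ^ 2) with hG
  have hcG : Continuous G := by simp only [hG]; fun_prop
  have hb0 : 0 ≤ b := hr₀.1.trans hr₀.2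
  have key : ∀ r ∈ Set.Icc 0 b, |H' r| / 2 ≤ G r := fun r hr =>
    abs_massDeriv_le φ hr.1 hX (hmax r hr)
  have h1 : (H r₀ - H 0) / 2 ≤ ∫ r in (0:ℝ)..r₀, G r := by
    rw [← intervalIntegral.integral_eq_sub_of_hasDerivAt (fun r _ => hd r)
      (hcH.intervalIntegrable _ _), ← intervalIntegral.integral_div]
    refine intervalIntegral.integral_mono_on hr₀.1
      ((hcH.div_const 2).intervalIntegrable _ _) (hcG.intervalIntegrable _ _) fun r hr => ?_
    have := key r ⟨hr.1, hr.2.trans hr₀.2⟩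
    linarith [le_abs_self (H' r)]
  have h2 : -(H b - H r₀) / 2 ≤ ∫ r in r₀..b, G r := by
    rw [← intervalIntegral.integral_eq_sub_of_hasDerivAt (fun r _ => hd r)
      (hcH.intervalIntegrable _ _), ← intervalIntegral.integral_neg,
      ← intervalIntegral.integral_div]
    refine intervalIntegral.integral_mono_on hr₀.2
      ((hcH.neg.div_const 2).intervalIntegrable _ _) (hcG.intervalIntegrable _ _) fun r hr => ?_
    have := key r ⟨hr₀.1.trans hr.1, hr.2⟩
    linarith [neg_le_abs (H' r)]
  have h3 : (∫ r in (0:ℝ)..r₀, G r) + ∫ r in r₀..b, G r = ∫ r in (0:ℝ)..b, G r :=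
    intervalIntegral.integral_add_adjacent_intervals (hcG.intervalIntegrable _ _)
      (hcG.intervalIntegrable _ _)
  have h4 : (∫ r in (0:ℝ)..b, G r) = (∫ r in (0:ℝ)..b, r ^ 2 * ‖deriv φ r‖ ^ 2)
      + b * ‖φ b‖ ^ 2 / 2 - (∫ r in (0:ℝ)..b, r ^ 2 * ‖φ r‖ ^ 6) / (4 * X ^ 2) := by
    have e1 : Continuous fun r => r ^ 2 * ‖deriv φ r‖ ^ 2 := by fun_prop
    have e2 : Continuous fun r => massDeriv φ r / 2 := by fun_prop
    have e3 : Continuous fun r => r ^ 2 * ‖φ r‖ ^ 6 / (4 * X ^ 2) := by fun_prop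
    have e12 : Continuous fun r => r ^ 2 * ‖deriv φ r‖ ^ 2 + massDeriv φ r / 2 := e1.add e2
    simp only [hG]
    rw [intervalIntegral.integral_sub (e12.intervalIntegrable _ _)
      (e3.intervalIntegrable _ _), intervalIntegral.integral_add (e1.intervalIntegrable _ _)
      (e2.intervalIntegrable _ _), intervalIntegral.integral_div, intervalIntegral.integral_div,
      intervalIntegral.integral_eq_sub_of_hasDerivAt (fun r _ => hasDerivAt_mul_norm_sq hφ r)
      (hcm.intervalIntegrable _ _)]
    simp
  have h5 : H 0 = 0 := by simp [hH, circArea_zero]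
  have h6 : H r₀ = Real.pi / 4 * X := by
    simp only [hH, hatt, div_self hX.ne', circArea_one]; ring
  have h7 : H b ≤ b * ‖φ b‖ ^ 2 := by
    have := circArea_le (y := b * ‖φ b‖ ^ 2 / X) (by positivity)
    calc H b ≤ X * (b * ‖φ b‖ ^ 2 / X) := mul_le_mul_of_nonneg_left this hX.le
      _ = _ := by field_simp
  linarith

lemma frequently_mul_norm_sq_lt {φ : ℝ → ℂ}
    (h6 : IntegrableOn (fun r => r ^ 2 * ‖φ r‖ ^ 6) (Set.Ioi 0)) {ε : ℝ} (hε : 0 < ε) :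
    ∃ᶠ b in Filter.atTop, b * ‖φ b‖ ^ 2 < ε := by
  intro hev
  obtain ⟨R, hR⟩ := Filter.eventually_atTop.1 hev
  set S := max R 1
  have hS : 0 < S := lt_of_lt_of_le one_pos (le_max_right _ _)
  have hi : IntegrableOn (fun r => r ^ 2 * ‖φ r‖ ^ 6) (Set.Ioi S) :=
    h6.mono_set (Set.Ioi_subset_Ioi hS.le)
  refine not_integrableOn_Ioi_inv (a := S) ?_
  refine Integrable.mono' (hi.const_mul (ε ^ 3)⁻¹) (by fun_prop) ?_
  refine (ae_restrict_mem measurableSet_Ioi).mono fun r hr => ?_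
  have hr' : S < r := hr
  have hr0 : 0 < r := hS.trans hr'
  have hp : ε ≤ r * ‖φ r‖ ^ 2 := not_lt.1 (hR r ((le_max_left _ _).trans hr'.le))
  have : ε ^ 3 ≤ (r * ‖φ r‖ ^ 2) ^ 3 := by gcongr
  rw [Real.norm_of_nonneg (by positivity), ← div_eq_inv_mul, le_div_iff₀ (by positivity),
    ← div_eq_inv_mul, div_le_iff₀ hr0]
  linarith [show (r * ‖φ r‖ ^ 2) ^ 3 = r ^ 2 * ‖φ r‖ ^ 6 * r by ring]

lemma intervalIntegral_le_integral_Ioi {g : ℝ → ℝ} (hg : IntegrableOn g (Set.Ioi 0))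
    (h0 : ∀ r, 0 ≤ g r) {b : ℝ} (hb : 0 ≤ b) : (∫ r in (0:ℝ)..b, g r) ≤ ∫ r in Set.Ioi 0, g r := by
  rw [intervalIntegral.integral_of_le hb]
  exact setIntegral_mono_set hg (Filter.Eventually.of_forall h0)
    (Filter.Eventually.of_forall fun _ hx => hx.1)

/-- Radial pointwise (Strauss-type) bound. -/
lemma mul_norm_sq_le {φ : ℝ → ℂ} (hφ : ContDiff ℝ 1 φ)
    (h6 : IntegrableOn (fun r => r ^ 2 * ‖φ r‖ ^ 6) (Set.Ioi 0))
    (h2 : IntegrableOn (fun r => r ^ 2 * ‖deriv φ r‖ ^ 2) (Set.Ioi 0)) {r : ℝ} (hr : 0 ≤ r) :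
    Real.pi / 4 * (r * ‖φ r‖ ^ 2) ≤ ∫ r in Set.Ioi 0, r ^ 2 * ‖deriv φ r‖ ^ 2 := by
  have hc := hφ.continuous
  refine le_of_forall_pos_le_add fun ε hε => ?_
  obtain ⟨b, hb, hrb⟩ :=
    ((frequently_mul_norm_sq_lt h6 hε).and_eventually (Filter.eventually_ge_atTop r)).exists
  have hI := intervalIntegral_le_integral_Ioi h2 (fun r => by positivity) (hr.trans hrb)
  obtain ⟨r₀, hr₀, hmax⟩ := isCompact_Icc.exists_isMaxOn (s := Set.Icc 0 b)
    ⟨r, hr, hrb⟩ (f := fun s => s * ‖φ s‖ ^ 2) (by fun_prop)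
  have hle : r * ‖φ r‖ ^ 2 ≤ r₀ * ‖φ r₀‖ ^ 2 := hmax ⟨hr, hrb⟩
  rcases (mul_nonneg hr₀.1 (sq_nonneg ‖φ r₀‖)).eq_or_lt with h0 | h0
  · have : 0 ≤ ∫ r in Set.Ioi 0, r ^ 2 * ‖deriv φ r‖ ^ 2 :=
      integral_nonneg fun r => by positivity
    nlinarith [Real.pi_pos]
  · have := radial_energy_lower_bound hφ h0 hr₀ (fun s hs => hmax hs) rfl
    have hn : 0 ≤ (∫ r in (0:ℝ)..b, r ^ 2 * ‖φ r‖ ^ 6) / (4 * (r₀ * ‖φ r₀‖ ^ 2) ^ 2) :=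
      div_nonneg (intervalIntegral.integral_nonneg (hr.trans hrb) fun s _ => by positivity)
        (by positivity)
    nlinarith [Real.pi_pos]

/-- Sharp radial Sobolev inequality in dimension three (Bliss). -/
lemma radial_sobolev {φ : ℝ → ℂ} (hφ : ContDiff ℝ 1 φ)
    (h6 : IntegrableOn (fun r => r ^ 2 * ‖φ r‖ ^ 6) (Set.Ioi 0))
    (h2 : IntegrableOn (fun r => r ^ 2 * ‖deriv φ r‖ ^ 2) (Set.Ioi 0)) :
    27 * Real.pi ^ 2 * (∫ r in Set.Ioi 0, r ^ 2 * ‖φ r‖ ^ 6) ≤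
      256 * (∫ r in Set.Ioi 0, r ^ 2 * ‖deriv φ r‖ ^ 2) ^ 3 := by
  have hc := hφ.continuous
  set A := ∫ r in Set.Ioi 0, r ^ 2 * ‖deriv φ r‖ ^ 2 with hA
  have hA0 : 0 ≤ A := integral_nonneg fun r => by positivity
  have step : ∀ ε > 0, 27 * Real.pi ^ 2 * (∫ r in Set.Ioi 0, r ^ 2 * ‖φ r‖ ^ 6) ≤
      256 * (A + ε) ^ 3 := fun ε hε => by
    have ht := (intervalIntegral_tendsto_integral_Ioi 0 h6 Filter.tendsto_id).const_mul
      (27 * Real.pi ^ 2)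
    refine le_of_tendsto_of_frequently ht ?_
    refine ((frequently_mul_norm_sq_lt h6 hε).and_eventually
      (Filter.eventually_gt_atTop 0)).mono fun b hb => ?_
    obtain ⟨hb, hb0⟩ := hb
    simp only [id]
    have hI := intervalIntegral_le_integral_Ioi h2 (fun r => by positivity) hb0.le
    obtain ⟨r₀, hr₀, hmax⟩ := isCompact_Icc.exists_isMaxOn (s := Set.Icc 0 b)
      ⟨b, hb0.le, le_rfl⟩ (f := fun s => s * ‖φ s‖ ^ 2) (by fun_prop)
    set B := ∫ r in (0:ℝ)..b, r ^ 2 * ‖φ r‖ ^ 6 with hB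
    rcases (mul_nonneg hr₀.1 (sq_nonneg ‖φ r₀‖)).eq_or_lt with h0 | h0
    · have hz : B ≤ 0 := by
        have : B ≤ ∫ r in (0:ℝ)..b, (0:ℝ) := by
          refine intervalIntegral.integral_mono_on hb0.le
            (Continuous.intervalIntegrable (by fun_prop) _ _)
            (Continuous.intervalIntegrable (by fun_prop) _ _) fun s hs => ?_
          have hs' : s * ‖φ s‖ ^ 2 ≤ r₀ * ‖φ r₀‖ ^ 2 := hmax hs
          have : s * ‖φ s‖ ^ 2 = 0 :=
            le_antisymm (by linarith) (mul_nonneg hs.1 (sq_nonneg _))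
          have e : s ^ 2 * ‖φ s‖ ^ 6 = (s * ‖φ s‖ ^ 2) ^ 2 * ‖φ s‖ ^ 2 := by ring
          rw [e, this]; simp
        simpa using this
      have : 27 * Real.pi ^ 2 * B ≤ 0 := mul_nonpos_of_nonneg_of_nonpos (by positivity) hz
      exact this.trans (by positivity)
    · set X := r₀ * ‖φ r₀‖ ^ 2 with hX
      have hm := radial_energy_lower_bound hφ h0 hr₀ (fun s hs => hmax hs) hX.symm
      rw [← hB] at hm
      have hB0 : 0 ≤ B := intervalIntegral.integral_nonneg hb0.le fun s _ => by positivity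
      have hπ := Real.pi_pos
      set c := B / (4 * X ^ 2) with hcdef
      have hc0 : 0 ≤ c := by positivity
      have hBc : B = 4 * X ^ 2 * c := by rw [hcdef]; field_simp
      have h1 : Real.pi / 4 * X + c ≤ A + ε := by linarith
      have h2 : (Real.pi / 4 * X + c) ^ 3 ≤ (A + ε) ^ 3 := by gcongr
      set y := Real.pi / 4 * X with hy
      have hy0 : 0 < y := by positivity
      have h3 : 27 * y ^ 2 * c ≤ 4 * (y + c) ^ 3 := by
        nlinarith [mul_nonneg (sq_nonneg (y - 2 * c)) (by positivity : 0 ≤ 4 * y + c)]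
      have h4 : 27 * Real.pi ^ 2 * B = 64 * (27 * y ^ 2 * c) := by
        rw [hBc, hy]; ring
      rw [h4]; linarith
  have hl : Filter.Tendsto (fun ε : ℝ => 256 * (A + ε) ^ 3) (nhdsWithin 0 (Set.Ioi 0))
      (nhds (256 * (A + 0) ^ 3)) :=
    (Continuous.tendsto (by fun_prop) 0).mono_left nhdsWithin_le_nhds
  rw [add_zero] at hl
  exact ge_of_tendsto hl (eventually_nhdsWithin_of_forall step)

lemma norm_e3 (i : Fin 3) : ‖e3 i‖ = 1 := by simp [e3]

lemma norm_smul_e3 (r : ℝ) (i : Fin 3) : ‖r • e3 i‖ = |r| := by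
  rw [norm_smul, norm_e3, mul_one, Real.norm_eq_abs]

/-- The profile of `f` along the first coordinate axis. -/
def radialProfile (f : E3 → ℂ) (r : ℝ) : ℂ := f (r • e3 0)

lemma IsRadial.eq_radialProfile {f : E3 → ℂ} (hr : IsRadial f) (x : E3) :
    f x = radialProfile f ‖x‖ :=
  hr _ _ (by rw [norm_smul_e3, abs_norm])

lemma contDiff_radialProfile {f : E3 → ℂ} (hf : ContDiff ℝ 1 f) :
    ContDiff ℝ 1 (radialProfile f) := by
  unfold radialProfile
  fun_prop

lemma gradSqC_of_isRadial {f : E3 → ℂ} (hr : IsRadial f) (hf : ContDiff ℝ 1 f) {x : E3}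
    (hx : x ≠ 0) : gradSqC f x = ‖deriv (radialProfile f) ‖x‖‖ ^ 2 := by
  have hx' : ‖x‖ ≠ 0 := norm_ne_zero_iff.2 hx
  have hn : HasFDerivAt (fun y : E3 => ‖y‖) (‖x‖⁻¹ • innerSL ℝ x) x := by
    have h := (hasStrictFDerivAt_norm_sq x).hasFDerivAt.sqrt (pow_ne_zero 2 hx')
    simp only [Real.sqrt_sq (norm_nonneg _)] at h
    refine h.congr_fderiv ?_
    ext v
    simp
    field_simp
  have hφ := ((contDiff_radialProfile hf).differentiable one_ne_zero ‖x‖).hasDerivAt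
  have hc := hφ.hasFDerivAt.comp x hn
  have he : f = radialProfile f ∘ fun y : E3 => ‖y‖ := funext hr.eq_radialProfile
  have hd : ∀ i, pdC i f x = (‖x‖⁻¹ * x i) • deriv (radialProfile f) ‖x‖ := fun i => by
    unfold pdC
    conv_lhs => rw [he]
    rw [hc.fderiv]
    simp [e3, EuclideanSpace.inner_single_right, mul_assoc]
  have hs : ∑ i, x i ^ 2 = ‖x‖ ^ 2 := by
    rw [EuclideanSpace.norm_sq_eq]; simp
  unfold gradSqC
  simp only [hd, norm_smul, mul_pow, Real.norm_eq_abs, sq_abs]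
  rw [← Finset.sum_mul, ← Finset.mul_sum, hs]
  field_simp

/-- The area of the unit sphere of ℝ³. -/
def sphereArea : ℝ := 3 * (volume : Measure E3).real (Metric.ball 0 1)

lemma sphereArea_pos : 0 < sphereArea := by
  have : 0 < (volume : Measure E3).real (Metric.ball 0 1) :=
    ENNReal.toReal_pos (Metric.measure_ball_pos _ _ one_pos).ne' measure_ball_lt_top.ne
  unfold sphereArea
  positivity

lemma integral_comp_norm (F : ℝ → ℝ) :
    ∫ x : E3, F ‖x‖ = sphereArea * ∫ r in Set.Ioi 0, r ^ 2 * F r := by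
  rw [integral_fun_norm_addHaar]
  simp [sphereArea, mul_assoc]

lemma integrable_comp_norm (F : ℝ → ℝ) :
    Integrable (fun x : E3 => F ‖x‖) ↔ IntegrableOn (fun r => r ^ 2 * F r) (Set.Ioi 0) := by
  rw [integrable_fun_norm_addHaar]
  simp

lemma IsRadial.norm_pow_eq {f : E3 → ℂ} (hr : IsRadial f) (n : ℕ) :
    (fun x => ‖f x‖ ^ n) = fun x => (fun r => ‖radialProfile f r‖ ^ n) ‖x‖ :=
  funext fun x => by rw [hr.eq_radialProfile x]

lemma gradSqC_ae_eq {f : E3 → ℂ} (hr : IsRadial f) (hf : ContDiff ℝ 1 f) :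
    gradSqC f =ᵐ[volume] fun x => (fun r => ‖deriv (radialProfile f) r‖ ^ 2) ‖x‖ := by
  filter_upwards [Measure.ae_ne volume (0 : E3)] with x hx
  exact gradSqC_of_isRadial hr hf hx

lemma integral_norm_pow {f : E3 → ℂ} (hr : IsRadial f) (n : ℕ) :
    ∫ x, ‖f x‖ ^ n = sphereArea * ∫ r in Set.Ioi 0, r ^ 2 * ‖radialProfile f r‖ ^ n := by
  rw [hr.norm_pow_eq]
  exact integral_comp_norm fun r => ‖radialProfile f r‖ ^ n

lemma integrable_norm_pow {f : E3 → ℂ} (hr : IsRadial f) (n : ℕ) :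
    Integrable (fun x => ‖f x‖ ^ n) ↔
      IntegrableOn (fun r => r ^ 2 * ‖radialProfile f r‖ ^ n) (Set.Ioi 0) := by
  rw [hr.norm_pow_eq]
  exact integrable_comp_norm fun r => ‖radialProfile f r‖ ^ n

lemma integral_gradSqC {f : E3 → ℂ} (hr : IsRadial f) (hf : ContDiff ℝ 1 f) :
    ∫ x, gradSqC f x =
      sphereArea * ∫ r in Set.Ioi 0, r ^ 2 * ‖deriv (radialProfile f) r‖ ^ 2 := by
  rw [integral_congr_ae (gradSqC_ae_eq hr hf)]
  exact integral_comp_norm fun r => ‖deriv (radialProfile f) r‖ ^ 2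

lemma integrable_gradSqC {f : E3 → ℂ} (hr : IsRadial f) (hf : ContDiff ℝ 1 f) :
    Integrable (gradSqC f) ↔
      IntegrableOn (fun r => r ^ 2 * ‖deriv (radialProfile f) r‖ ^ 2) (Set.Ioi 0) := by
  rw [integrable_congr (gradSqC_ae_eq hr hf)]
  exact integrable_comp_norm fun r => ‖deriv (radialProfile f) r‖ ^ 2

/-- The radial profile of the ground state. -/
def groundProfile (r : ℝ) : ℝ := (1 + r ^ 2 / 3) ^ (-(1 : ℝ) / 2)

lemma W_eq_groundProfile (x : E3) : W x = groundProfile ‖x‖ := rfl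

lemma groundProfile_abs (r : ℝ) : groundProfile |r| = groundProfile r := by
  simp [groundProfile]

lemma groundProfile_pos (r : ℝ) : 0 < groundProfile r := by
  unfold groundProfile; positivity

lemma groundProfile_sq (r : ℝ) : groundProfile r ^ 2 = (1 + r ^ 2 / 3)⁻¹ := by
  rw [groundProfile, ← Real.rpow_natCast, ← Real.rpow_mul (by positivity)]
  norm_num [Real.rpow_neg_one]

lemma hasDerivAt_groundProfile (r : ℝ) :
    HasDerivAt groundProfile (-(r / 3) * groundProfile r ^ 3) r := by
  have h0 : HasDerivAt (fun s : ℝ => 1 + s ^ 2 / 3) (2 * r / 3) r := by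
    have := ((hasDerivAt_pow 2 r).div_const 3).const_add 1
    refine this.congr_deriv ?_
    norm_num
  have hq : (0:ℝ) < 1 + r ^ 2 / 3 := by positivity
  refine (h0.rpow_const (p := -(1 : ℝ) / 2) (Or.inl hq.ne')).congr_deriv ?_
  have : (1 + r ^ 2 / 3) ^ (-(1 : ℝ) / 2 - 1) = groundProfile r ^ 3 := by
    rw [groundProfile, ← Real.rpow_natCast (_ ^ (-(1 : ℝ) / 2)), ← Real.rpow_mul hq.le]
    norm_num
  rw [this]; ring

lemma deriv_groundProfile_sq (r : ℝ) :
    (-(r / 3) * groundProfile r ^ 3) ^ 2 = r ^ 2 / 9 / (1 + r ^ 2 / 3) ^ 3 := by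
  have : (-(r / 3) * groundProfile r ^ 3) ^ 2 = r ^ 2 / 9 * (groundProfile r ^ 2) ^ 3 := by ring
  rw [this, groundProfile_sq, inv_pow]; rfl

lemma groundProfile_pow_six (r : ℝ) : groundProfile r ^ 6 = 1 / (1 + r ^ 2 / 3) ^ 3 := by
  have : groundProfile r ^ 6 = (groundProfile r ^ 2) ^ 3 := by ring
  rw [this, groundProfile_sq, inv_pow, one_div]

lemma contDiff_W : ContDiff ℝ 1 W := by
  have h : ContDiff ℝ 1 fun x : E3 => 1 + ‖x‖ ^ 2 / 3 :=
    contDiff_const.add ((contDiff_norm_sq ℝ).div_const 3)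
  exact h.rpow_const_of_ne fun x => by positivity

lemma isRadial_Wc : IsRadial Wc := fun x y h => by
  simp only [Wc, W, h]

lemma contDiff_Wc : ContDiff ℝ 1 Wc := Complex.ofRealCLM.contDiff.comp contDiff_W

lemma radialProfile_Wc : radialProfile Wc = fun r => (groundProfile r : ℂ) := by
  funext r
  rw [radialProfile, Wc, W_eq_groundProfile, norm_smul_e3, groundProfile_abs]

lemma deriv_radialProfile_Wc (r : ℝ) :
    deriv (radialProfile Wc) r = ((-(r / 3) * groundProfile r ^ 3 : ℝ) : ℂ) := by
  rw [radialProfile_Wc]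
  exact (hasDerivAt_groundProfile r).ofReal_comp.deriv

lemma gradSqC_Wc (x : E3) : gradSqC Wc x = gradSqR W x := by
  unfold gradSqC gradSqR
  refine Finset.sum_congr rfl fun i _ => ?_
  have h := Complex.ofRealCLM.hasFDerivAt.comp x
    (contDiff_W.differentiable one_ne_zero x).hasFDerivAt
  have : pdC i Wc x = (pdR i W x : ℂ) := by
    unfold pdC
    have h' : HasFDerivAt Wc _ x := h
    rw [h'.fderiv]
    simp [pdR]
  rw [this, Complex.norm_real, Real.norm_eq_abs, sq_abs]

lemma tendsto_div_one_add_sq_sq :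
    Filter.Tendsto (fun s : ℝ => s * (s ^ 2 - 1) / (1 + s ^ 2) ^ 2) Filter.atTop (nhds 0) := by
  refine squeeze_zero_norm' ?_ tendsto_inv_atTop_zero
  filter_upwards [Filter.eventually_gt_atTop 0] with s hs
  rw [norm_div, norm_mul, Real.norm_of_nonneg hs.le,
    Real.norm_of_nonneg (by positivity : 0 ≤ (1 + s ^ 2) ^ 2), div_le_iff₀ (by positivity),
    inv_mul_eq_div, le_div_iff₀ hs]
  have : ‖s ^ 2 - 1‖ ≤ 1 + s ^ 2 := by
    rw [Real.norm_eq_abs, abs_le]; constructor <;> nlinarith [sq_nonneg s]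
  nlinarith [mul_le_mul_of_nonneg_left this (sq_nonneg s), sq_nonneg s]

lemma tendsto_div_one_add_sq :
    Filter.Tendsto (fun s : ℝ => s / (1 + s ^ 2)) Filter.atTop (nhds 0) := by
  refine squeeze_zero_norm' ?_ tendsto_inv_atTop_zero
  filter_upwards [Filter.eventually_gt_atTop 0] with s hs
  rw [Real.norm_of_nonneg (by positivity), div_le_iff₀ (by positivity), inv_mul_eq_div,
    le_div_iff₀ hs]
  nlinarith

lemma hasDerivAt_div_one_add_sq (s : ℝ) :
    HasDerivAt (fun s : ℝ => s / (1 + s ^ 2)) ((1 - s ^ 2) / (1 + s ^ 2) ^ 2) s := by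
  have hq : (1 + s ^ 2) ≠ 0 := by positivity
  refine ((hasDerivAt_id s).div ((hasDerivAt_pow 2 s).const_add 1) hq).congr_deriv ?_
  simp only [id]; push_cast; ring

lemma hasDerivAt_div_one_add_sq_sq (s : ℝ) :
    HasDerivAt (fun s : ℝ => s * (s ^ 2 - 1) / (1 + s ^ 2) ^ 2)
      ((-s ^ 4 + 6 * s ^ 2 - 1) / (1 + s ^ 2) ^ 3) s := by
  have hq : (1 + s ^ 2) ≠ 0 := by positivity
  refine (((hasDerivAt_id s).mul ((hasDerivAt_pow 2 s).sub_const 1)).div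
    (((hasDerivAt_pow 2 s).const_add 1).pow 2) (pow_ne_zero 2 hq)).congr_deriv ?_
  simp only [id, Pi.mul_apply, Pi.pow_apply]; push_cast; field_simp; ring

lemma tendsto_comp_div_sqrt_three {P : ℝ → ℝ} {l : ℝ}
    (h : Filter.Tendsto P Filter.atTop (nhds l)) :
    Filter.Tendsto (fun r => P (r / √3)) Filter.atTop (nhds l) :=
  h.comp (Filter.tendsto_id.atTop_div_const (by positivity))

lemma tendsto_arctan : Filter.Tendsto Real.arctan Filter.atTop (nhds (Real.pi / 2)) :=
  Real.tendsto_arctan_atTop.mono_right nhdsWithin_le_nhds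

/-- Primitive of the radial sextic density of `W`. -/
lemma hasDerivAt_primitive_six (r : ℝ) :
    HasDerivAt (fun r : ℝ => 3 * √3 / 8 * (Real.arctan (r / √3)
      + (r / √3) * ((r / √3) ^ 2 - 1) / (1 + (r / √3) ^ 2) ^ 2))
      (r ^ 2 * groundProfile r ^ 6) r := by
  have hd : HasDerivAt (fun r : ℝ => r / √3) (1 / √3) r := (hasDerivAt_id r).div_const _
  refine ((((Real.hasDerivAt_arctan _).comp r hd).add
    ((hasDerivAt_div_one_add_sq_sq _).comp r hd)).const_mul (3 * √3 / 8)).congr_deriv ?_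
  have h3 : √3 ^ 2 = (3:ℝ) := Real.sq_sqrt (by norm_num)
  rw [groundProfile_pow_six]
  have e : (r / √3) ^ 2 = r ^ 2 / 3 := by rw [div_pow, h3]
  have e4 : (r / √3) ^ 4 = (r ^ 2 / 3) ^ 2 := by rw [← e]; ring
  rw [e4, e]
  field_simp
  ring

/-- Primitive of the radial Dirichlet density of `W`. -/
lemma hasDerivAt_primitive_two (r : ℝ) :
    HasDerivAt (fun r : ℝ => √3 * (3 / 8 * Real.arctan (r / √3)
      - 1 / 2 * ((r / √3) / (1 + (r / √3) ^ 2))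
      - 1 / 8 * ((r / √3) * ((r / √3) ^ 2 - 1) / (1 + (r / √3) ^ 2) ^ 2)))
      (r ^ 2 * (-(r / 3) * groundProfile r ^ 3) ^ 2) r := by
  have hd : HasDerivAt (fun r : ℝ => r / √3) (1 / √3) r := (hasDerivAt_id r).div_const _
  refine ((((((Real.hasDerivAt_arctan _).comp r hd).const_mul (3 / 8)).sub
    (((hasDerivAt_div_one_add_sq _).comp r hd).const_mul (1 / 2))).sub
    (((hasDerivAt_div_one_add_sq_sq _).comp r hd).const_mul (1 / 8))).const_mul
      √3).congr_deriv ?_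
  have h3 : √3 ^ 2 = (3:ℝ) := Real.sq_sqrt (by norm_num)
  rw [deriv_groundProfile_sq]
  have e : (r / √3) ^ 2 = r ^ 2 / 3 := by rw [div_pow, h3]
  have e4 : (r / √3) ^ 4 = (r ^ 2 / 3) ^ 2 := by rw [← e]; ring
  rw [e4, e]
  field_simp
  ring

lemma tendsto_primitive_six :
    Filter.Tendsto (fun r : ℝ => 3 * √3 / 8 * (Real.arctan (r / √3)
      + (r / √3) * ((r / √3) ^ 2 - 1) / (1 + (r / √3) ^ 2) ^ 2)) Filter.atTop
      (nhds (3 * √3 * Real.pi / 16)) := by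
  have := tendsto_comp_div_sqrt_three
    ((tendsto_arctan.add tendsto_div_one_add_sq_sq).const_mul (3 * √3 / 8))
  convert! this using 2
  ring

lemma tendsto_primitive_two :
    Filter.Tendsto (fun r : ℝ => √3 * (3 / 8 * Real.arctan (r / √3)
      - 1 / 2 * ((r / √3) / (1 + (r / √3) ^ 2))
      - 1 / 8 * ((r / √3) * ((r / √3) ^ 2 - 1) / (1 + (r / √3) ^ 2) ^ 2))) Filter.atTop
      (nhds (3 * √3 * Real.pi / 16)) := by
  have := tendsto_comp_div_sqrt_three
    ((((tendsto_arctan.const_mul (3 / 8)).sub (tendsto_div_one_add_sq.const_mul (1 / 2))).sub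
      (tendsto_div_one_add_sq_sq.const_mul (1 / 8))).const_mul √3)
  convert! this using 2
  ring

lemma integrableOn_groundProfile_six :
    IntegrableOn (fun r => r ^ 2 * groundProfile r ^ 6) (Set.Ioi 0) :=
  integrableOn_Ioi_deriv_of_nonneg' (fun r _ => hasDerivAt_primitive_six r)
    (fun r _ => by have := groundProfile_pos r; positivity) tendsto_primitive_six

lemma integral_groundProfile_six :
    ∫ r in Set.Ioi 0, r ^ 2 * groundProfile r ^ 6 = 3 * √3 * Real.pi / 16 := by
  rw [integral_Ioi_of_hasDerivAt_of_nonneg' (fun r _ => hasDerivAt_primitive_six r)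
    (fun r _ => by have := groundProfile_pos r; positivity) tendsto_primitive_six]
  simp

lemma integrableOn_groundProfile_two :
    IntegrableOn (fun r => r ^ 2 * (-(r / 3) * groundProfile r ^ 3) ^ 2) (Set.Ioi 0) :=
  integrableOn_Ioi_deriv_of_nonneg' (fun r _ => hasDerivAt_primitive_two r)
    (fun r _ => by positivity) tendsto_primitive_two

lemma integral_groundProfile_two :
    ∫ r in Set.Ioi 0, r ^ 2 * (-(r / 3) * groundProfile r ^ 3) ^ 2 = 3 * √3 * Real.pi / 16 := by
  rw [integral_Ioi_of_hasDerivAt_of_nonneg' (fun r _ => hasDerivAt_primitive_two r)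
    (fun r _ => by positivity) tendsto_primitive_two]
  simp

lemma integrable_gradSqC_Wc : Integrable (gradSqC Wc) := by
  rw [integrable_gradSqC isRadial_Wc contDiff_Wc]
  simpa only [deriv_radialProfile_Wc, Complex.norm_real, Real.norm_eq_abs, sq_abs]
    using integrableOn_groundProfile_two

lemma integral_gradSqC_Wc : ∫ x, gradSqC Wc x = sphereArea * (3 * √3 * Real.pi / 16) := by
  rw [integral_gradSqC isRadial_Wc contDiff_Wc, ← integral_groundProfile_two]
  simp only [deriv_radialProfile_Wc, Complex.norm_real, Real.norm_eq_abs, sq_abs]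

lemma norm_radialProfile_Wc (r : ℝ) : ‖radialProfile Wc r‖ = groundProfile r := by
  rw [radialProfile_Wc, Complex.norm_real, Real.norm_of_nonneg (groundProfile_pos r).le]

lemma integrable_Wc_six : Integrable fun x => ‖Wc x‖ ^ 6 := by
  rw [integrable_norm_pow isRadial_Wc]
  simpa only [norm_radialProfile_Wc] using integrableOn_groundProfile_six

lemma integral_Wc_six : ∫ x, ‖Wc x‖ ^ 6 = sphereArea * (3 * √3 * Real.pi / 16) := by
  rw [integral_norm_pow isRadial_Wc, ← integral_groundProfile_six]
  simp only [norm_radialProfile_Wc]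

/-- Sharp Sobolev inequality for radial functions, normalised by the ground state. -/
lemma sobolev_of_isRadial {f : E3 → ℂ} (hr : IsRadial f) (hf : ContDiff ℝ 1 f)
    (h6 : Integrable fun x => ‖f x‖ ^ 6) (h2 : Integrable (gradSqC f)) :
    (∫ x, gradSqC Wc x) ^ 2 * ∫ x, ‖f x‖ ^ 6 ≤ (∫ x, gradSqC f x) ^ 3 := by
  have h := radial_sobolev (contDiff_radialProfile hf) ((integrable_norm_pow hr 6).1 h6)
    ((integrable_gradSqC hr hf).1 h2)
  rw [integral_gradSqC_Wc, integral_norm_pow hr, integral_gradSqC hr hf]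
  set A := ∫ r in Set.Ioi 0, r ^ 2 * ‖deriv (radialProfile f) r‖ ^ 2
  set B := ∫ r in Set.Ioi 0, r ^ 2 * ‖radialProfile f r‖ ^ 6
  have h3 : √3 ^ 2 = (3:ℝ) := Real.sq_sqrt (by norm_num)
  have e : (sphereArea * (3 * √3 * Real.pi / 16)) ^ 2 * (sphereArea * B) =
      sphereArea ^ 3 / 256 * (27 * Real.pi ^ 2 * B) := by
    calc _ = sphereArea ^ 3 / 256 * (9 * √3 ^ 2 * Real.pi ^ 2 * B) := by ring
      _ = _ := by rw [h3]; ring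
  rw [e]
  have := mul_le_mul_of_nonneg_left h
    (by have := sphereArea_pos; positivity : 0 ≤ sphereArea ^ 3 / 256)
  linarith

/-- At the threshold energy the quartic term is controlled by the gradient gap. -/
lemma integral_norm_pow_four_le {f : E3 → ℂ} (hr : IsRadial f) (hf : ContDiff ℝ 1 f)
    (h4 : Integrable fun x => ‖f x‖ ^ 4) (h6 : Integrable fun x => ‖f x‖ ^ 6)
    (h2 : Integrable (gradSqC f)) (hE : Ecq f = Ecrit Wc)
    (hN : ∫ x, gradSqC f x ≤ 2 * ∫ x, gradSqC Wc x) :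
    ∫ x, ‖f x‖ ^ 4 ≤ 8 * deltaF f := by
  have hs := sobolev_of_isRadial hr hf h6 h2
  have hK : 0 < ∫ x, gradSqC Wc x := by
    rw [integral_gradSqC_Wc]
    have := sphereArea_pos
    have := Real.pi_pos
    positivity
  have hKL : ∫ x, ‖Wc x‖ ^ 6 = ∫ x, gradSqC Wc x := by
    rw [integral_Wc_six, integral_gradSqC_Wc]
  have hδ : deltaF f = |(∫ x, gradSqC Wc x) - ∫ x, gradSqC f x| := by
    simp only [deltaF, gradSqC_Wc]
  have hE1 : Ecq f = 1 / 2 * (∫ x, gradSqC f x) - 1 / 6 * (∫ x, ‖f x‖ ^ 6)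
      + 1 / 4 * ∫ x, ‖f x‖ ^ 4 := by
    have a := h2.const_mul (1 / 2)
    have b := h6.const_mul (1 / 6)
    have ab : Integrable fun x => (1:ℝ) / 2 * gradSqC f x - 1 / 6 * ‖f x‖ ^ 6 := a.sub b
    rw [Ecq, integral_add ab (h4.const_mul (1 / 4)), integral_sub a b, integral_const_mul,
      integral_const_mul, integral_const_mul]
  have hE2 : Ecrit Wc = 1 / 2 * (∫ x, gradSqC Wc x) - 1 / 6 * ∫ x, ‖Wc x‖ ^ 6 := by
    rw [Ecrit, integral_sub (integrable_gradSqC_Wc.const_mul _) (integrable_Wc_six.const_mul _),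
      integral_const_mul, integral_const_mul]
  rw [hE1, hE2, hKL] at hE
  rw [hδ]
  have hN0 : 0 ≤ ∫ x, gradSqC f x :=
    integral_nonneg fun x => Finset.sum_nonneg fun i _ => sq_nonneg _
  set K := ∫ x, gradSqC Wc x
  set N := ∫ x, gradSqC f x
  set S := ∫ x, ‖f x‖ ^ 6
  have h1 : K - N ≤ |K - N| := le_abs_self _
  have h5 : N - K ≤ |K - N| := by rw [abs_sub_comm]; exact le_abs_self _
  have hSK : S - K ≤ 7 * |K - N| := by
    have hq : N ^ 2 + N * K + K ^ 2 ≤ 7 * K ^ 2 := by nlinarith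
    have hq0 : 0 ≤ N ^ 2 + N * K + K ^ 2 := by positivity
    have : K ^ 2 * (S - K) ≤ K ^ 2 * (7 * |K - N|) := by
      calc K ^ 2 * (S - K) ≤ (N - K) * (N ^ 2 + N * K + K ^ 2) := by linarith
        _ ≤ |K - N| * (N ^ 2 + N * K + K ^ 2) := mul_le_mul_of_nonneg_right h5 hq0
        _ ≤ |K - N| * (7 * K ^ 2) := mul_le_mul_of_nonneg_left hq (abs_nonneg _)
        _ = _ := by ring
    exact le_of_mul_le_mul_left this (by positivity)
  linarith [abs_nonneg (K - N)]

lemma isRadial_modG {f : E3 → ℂ} (hr : IsRadial f) (θ μ : ℝ) : IsRadial (modG f θ μ) :=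
  fun x y h => by
    have : W (μ • x) = W (μ • y) := by
      simp only [W_eq_groundProfile, norm_smul, h]
    simp only [modG, hr x y h, this]

lemma contDiff_modG {f : E3 → ℂ} (hf : ContDiff ℝ 1 f) (θ μ : ℝ) :
    ContDiff ℝ 1 (modG f θ μ) := by
  have h1 : ContDiff ℝ 1 fun x : E3 => W (μ • x) :=
    contDiff_W.comp (contDiff_const_smul μ)
  have h2 : ContDiff ℝ 1 fun x : E3 => ((√μ * W (μ • x) : ℝ) : ℂ) :=
    Complex.ofRealCLM.contDiff.comp (contDiff_const.mul h1)
  exact (contDiff_const.mul hf).sub h2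

lemma radialProfile_modG (f : E3 → ℂ) (θ μ r : ℝ) :
    radialProfile (modG f θ μ) r = Complex.exp (-θ * Complex.I) * radialProfile f r
      - ((√μ * groundProfile (μ * r) : ℝ) : ℂ) := by
  rw [radialProfile, modG, W_eq_groundProfile, smul_smul, norm_smul_e3, groundProfile_abs]
  rfl

lemma norm_exp_neg_mul_I (θ : ℝ) : ‖Complex.exp (-θ * Complex.I)‖ = 1 := by
  rw [← Complex.ofReal_neg, Complex.norm_exp_ofReal_mul_I]

lemma deriv_radialProfile_modG {f : E3 → ℂ} (hf : ContDiff ℝ 1 f) (θ μ r : ℝ) :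
    deriv (radialProfile (modG f θ μ)) r =
      Complex.exp (-θ * Complex.I) * deriv (radialProfile f) r
      - ((√μ * (-(μ * r / 3) * groundProfile (μ * r) ^ 3 * μ) : ℝ) : ℂ) := by
  have h1 := ((contDiff_radialProfile hf).differentiable one_ne_zero r).hasDerivAt
  have hm : HasDerivAt (fun r : ℝ => μ * r) μ r := by
    simpa using (hasDerivAt_id r).const_mul μ
  have h2 := (((hasDerivAt_groundProfile (μ * r)).comp r hm).const_mul √μ).ofReal_comp
  have h3 := (h1.const_mul (Complex.exp (-θ * Complex.I))).sub h2
  rw [funext (radialProfile_modG f θ μ)]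
  exact h3.deriv

lemma norm_sub_sq_le (a b : ℂ) : ‖a - b‖ ^ 2 ≤ 2 * (‖a‖ ^ 2 + ‖b‖ ^ 2) := by
  have : ‖a - b‖ ^ 2 ≤ (‖a‖ + ‖b‖) ^ 2 := by gcongr; exact norm_sub_le a b
  exact this.trans add_sq_le

lemma norm_sub_pow_six_le (a b : ℂ) : ‖a - b‖ ^ 6 ≤ 32 * (‖a‖ ^ 6 + ‖b‖ ^ 6) := by
  have : ‖a - b‖ ^ 6 ≤ (‖a‖ + ‖b‖) ^ 6 := by gcongr; exact norm_sub_le a b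
  have h := add_pow_le (norm_nonneg a) (norm_nonneg b) 6
  norm_num at h
  exact this.trans h

lemma integrableOn_radialProfile_modG_six {f : E3 → ℂ} (hr : IsRadial f) (hf : ContDiff ℝ 1 f)
    (h6 : Integrable fun x => ‖f x‖ ^ 6) (θ : ℝ) {μ : ℝ} (hμ : 0 < μ) :
    IntegrableOn (fun r => r ^ 2 * ‖radialProfile (modG f θ μ) r‖ ^ 6) (Set.Ioi 0) := by
  have a := (integrable_norm_pow hr 6).1 h6
  have b := (integrableOn_Ioi_comp_mul_left_iff (fun r => r ^ 2 * groundProfile r ^ 6) 0 hμ).2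
    (by simpa using integrableOn_groundProfile_six)
  have hc := (contDiff_radialProfile (contDiff_modG hf θ μ)).continuous
  refine ((a.add (b.const_mul μ)).const_mul 32).mono'
    (Continuous.aestronglyMeasurable (by fun_prop)) (ae_of_all _ fun r => ?_)
  have hs : √μ ^ 6 = μ ^ 3 := by
    rw [show √μ ^ 6 = (√μ ^ 2) ^ 3 by ring, Real.sq_sqrt hμ.le]
  have hw : ‖((√μ * groundProfile (μ * r) : ℝ) : ℂ)‖ ^ 6 = μ ^ 3 * groundProfile (μ * r) ^ 6 := by
    rw [Complex.norm_real, Real.norm_of_nonneg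
      (mul_nonneg (Real.sqrt_nonneg _) (groundProfile_pos _).le), mul_pow, hs]
  have := norm_sub_pow_six_le (Complex.exp (-θ * Complex.I) * radialProfile f r)
    ((√μ * groundProfile (μ * r) : ℝ) : ℂ)
  rw [norm_mul, norm_exp_neg_mul_I, one_mul, hw, ← radialProfile_modG] at this
  rw [Real.norm_of_nonneg (by positivity)]
  refine (mul_le_mul_of_nonneg_left this (sq_nonneg r)).trans (le_of_eq ?_)
  simp only [Pi.add_apply]
  ring

lemma integrableOn_deriv_radialProfile_modG {f : E3 → ℂ} (hr : IsRadial f)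
    (hf : ContDiff ℝ 1 f) (h2 : Integrable (gradSqC f)) (θ : ℝ) {μ : ℝ} (hμ : 0 < μ) :
    IntegrableOn (fun r => r ^ 2 * ‖deriv (radialProfile (modG f θ μ)) r‖ ^ 2) (Set.Ioi 0) := by
  have a := (integrable_gradSqC hr hf).1 h2
  have b := (integrableOn_Ioi_comp_mul_left_iff
    (fun r => r ^ 2 * (-(r / 3) * groundProfile r ^ 3) ^ 2) 0 hμ).2
    (by simpa using integrableOn_groundProfile_two)
  have hc := (contDiff_radialProfile (contDiff_modG hf θ μ)).continuous_deriv le_rfl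
  refine ((a.add (b.const_mul μ)).const_mul 2).mono'
    (Continuous.aestronglyMeasurable (by fun_prop)) (ae_of_all _ fun r => ?_)
  have hw : ‖((√μ * (-(μ * r / 3) * groundProfile (μ * r) ^ 3 * μ) : ℝ) : ℂ)‖ ^ 2 =
      μ ^ 3 * (-(μ * r / 3) * groundProfile (μ * r) ^ 3) ^ 2 := by
    rw [Complex.norm_real, Real.norm_eq_abs, sq_abs, mul_pow, Real.sq_sqrt hμ.le]
    ring
  have := norm_sub_sq_le (Complex.exp (-θ * Complex.I) * deriv (radialProfile f) r)
    ((√μ * (-(μ * r / 3) * groundProfile (μ * r) ^ 3 * μ) : ℝ) : ℂ)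
  rw [norm_mul, norm_exp_neg_mul_I, one_mul, hw, ← deriv_radialProfile_modG hf] at this
  rw [Real.norm_of_nonneg (by positivity)]
  refine (mul_le_mul_of_nonneg_left this (sq_nonneg r)).trans (le_of_eq ?_)
  simp only [Pi.add_apply]
  ring

lemma le_groundProfile {s : ℝ} (h0 : 0 ≤ s) (h1 : s ≤ 1) : 3 / 4 ≤ groundProfile s := by
  have h := groundProfile_sq s
  have : (3 / 4 : ℝ) ≤ (1 + s ^ 2 / 3)⁻¹ := by
    rw [le_inv_comm₀ (by norm_num) (by positivity)]
    nlinarith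
  rw [← h] at this
  nlinarith [groundProfile_pos s]

/-- Near the modulated ground state, the profile has size `μ^{1/2}` at distance `μ⁻¹`. -/
lemma sqrt_div_two_le_norm_radialProfile {f : E3 → ℂ} (hr : IsRadial f) (hf : ContDiff ℝ 1 f)
    (h6 : Integrable fun x => ‖f x‖ ^ 6) (h2 : Integrable (gradSqC f)) {θ μ : ℝ} (hμ : 0 < μ)
    (hg : ∫ x, gradSqC (modG f θ μ) x ≤ Real.pi * sphereArea / 128) {r : ℝ}
    (hr1 : 1 / (2 * μ) ≤ r) (hr2 : r ≤ 1 / μ) : √μ / 2 ≤ ‖radialProfile f r‖ := by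
  have hω := sphereArea_pos
  have hπ := Real.pi_pos
  have hr0 : 0 < r := lt_of_lt_of_le (by positivity) hr1
  have hp := mul_norm_sq_le (contDiff_radialProfile (contDiff_modG hf θ μ))
    (integrableOn_radialProfile_modG_six hr hf h6 θ hμ)
    (integrableOn_deriv_radialProfile_modG hr hf h2 θ hμ) hr0.le
  rw [integral_gradSqC (isRadial_modG hr θ μ) (contDiff_modG hf θ μ)] at hg
  set A := ∫ r in Set.Ioi 0, r ^ 2 * ‖deriv (radialProfile (modG f θ μ)) r‖ ^ 2
  set γ := radialProfile (modG f θ μ) r with hγ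
  have hA : A ≤ Real.pi / 128 := by
    refine le_of_mul_le_mul_left ?_ hω
    linarith
  have hγ1 : r * ‖γ‖ ^ 2 ≤ 1 / 32 := by
    refine le_of_mul_le_mul_left ?_ hπ
    linarith
  have hγ2 : ‖γ‖ ^ 2 ≤ (√μ / 4) ^ 2 := by
    rw [div_pow, Real.sq_sqrt hμ.le]
    have h1 : 1 / (2 * μ) * ‖γ‖ ^ 2 ≤ 1 / 32 :=
      (mul_le_mul_of_nonneg_right hr1 (sq_nonneg _)).trans hγ1
    have h2 : ‖γ‖ ^ 2 = 2 * μ * (1 / (2 * μ) * ‖γ‖ ^ 2) := by field_simp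
    rw [h2]
    nlinarith
  have hγ3 : ‖γ‖ ≤ √μ / 4 := by
    have := Real.sqrt_nonneg μ
    exact (pow_le_pow_iff_left₀ (norm_nonneg _) (by positivity) two_ne_zero).1 hγ2
  have hw : 3 / 4 ≤ groundProfile (μ * r) := by
    refine le_groundProfile (by positivity) ?_
    rw [le_div_iff₀ hμ] at hr2
    linarith
  have htri : √μ * groundProfile (μ * r) ≤ ‖radialProfile f r‖ + ‖γ‖ := by
    have e : ((√μ * groundProfile (μ * r) : ℝ) : ℂ) =
        Complex.exp (-θ * Complex.I) * radialProfile f r - γ := by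
      rw [hγ, radialProfile_modG]; ring
    have h := norm_sub_le (Complex.exp (-θ * Complex.I) * radialProfile f r) γ
    rw [← e, norm_mul, norm_exp_neg_mul_I, one_mul, Complex.norm_real,
      Real.norm_of_nonneg (mul_nonneg (Real.sqrt_nonneg _) (groundProfile_pos _).le)] at h
    exact h
  nlinarith [mul_le_mul_of_nonneg_left hw (Real.sqrt_nonneg μ)]

/-- Near the modulated ground state the quartic norm is at least of order `μ⁻¹`. -/
lemma le_integral_norm_pow_four {f : E3 → ℂ} (hr : IsRadial f) (hf : ContDiff ℝ 1 f)
    (h4 : Integrable fun x => ‖f x‖ ^ 4) (h6 : Integrable fun x => ‖f x‖ ^ 6)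
    (h2 : Integrable (gradSqC f)) {θ μ : ℝ} (hμ : 0 < μ)
    (hg : ∫ x, gradSqC (modG f θ μ) x ≤ Real.pi * sphereArea / 128) :
    sphereArea / (128 * μ) ≤ ∫ x, ‖f x‖ ^ 4 := by
  rw [integral_norm_pow hr, div_eq_mul_one_div]
  refine mul_le_mul_of_nonneg_left ?_ sphereArea_pos.le
  have hi := (integrable_norm_pow hr 4).1 h4
  have hc := (contDiff_radialProfile hf).continuous
  have hab : 1 / (2 * μ) ≤ 1 / μ := one_div_le_one_div_of_le hμ (by linarith)
  have ha : 0 < 1 / (2 * μ) := by positivity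
  have hlow : (∫ _ in (1 / (2 * μ))..(1 / μ), (1 / 64 : ℝ)) ≤
      ∫ r in (1 / (2 * μ))..(1 / μ), r ^ 2 * ‖radialProfile f r‖ ^ 4 := by
    refine intervalIntegral.integral_mono_on hab (by simp)
      (Continuous.intervalIntegrable (by fun_prop) _ _) fun r hr' => ?_
    have h := sqrt_div_two_le_norm_radialProfile hr hf h6 h2 hμ hg hr'.1 hr'.2
    have e1 : (√μ / 2) ^ 4 ≤ ‖radialProfile f r‖ ^ 4 := by gcongr
    have e2 : (1 / (2 * μ)) ^ 2 ≤ r ^ 2 := by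
      have := hr'.1
      gcongr
    have e3 : (√μ / 2) ^ 4 = μ ^ 2 / 16 := by
      rw [show (√μ / 2) ^ 4 = (√μ ^ 2) ^ 2 / 16 by ring, Real.sq_sqrt hμ.le]
    calc (1 / 64 : ℝ) = (1 / (2 * μ)) ^ 2 * (√μ / 2) ^ 4 := by rw [e3]; field_simp; norm_num
      _ ≤ _ := mul_le_mul e2 e1 (by positivity) (sq_nonneg r)
  have e : (∫ _ in (1 / (2 * μ))..(1 / μ), (1 / 64 : ℝ)) = 1 / (128 * μ) := by
    rw [intervalIntegral.integral_const, smul_eq_mul]; field_simp; norm_num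
  rw [e, intervalIntegral.integral_of_le hab] at hlow
  exact hlow.trans (setIntegral_mono_set hi (ae_of_all _ fun r => by positivity)
    (ae_of_all _ fun r h => ha.trans h.1))

/-- Lower bound on the modulation scale from the mass. -/
theorem mass_bounds_modulation_scale :
    ∀ M > (0:ℝ), ∃ δ₀ > (0:ℝ), ∃ C > (0:ℝ), ∀ (f : E3 → ℂ) (θ μ : ℝ), 0 < μ →
      IsRadial f → ContDiff ℝ 1 f →
      Integrable (fun x : E3 => ‖f x‖ ^ 2) →
      Integrable (fun x : E3 => ‖f x‖ ^ 4) →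
      Integrable (fun x : E3 => ‖f x‖ ^ 6) →
      Integrable (gradSqC f) →
      Real.sqrt (∫ x : E3, ‖f x‖ ^ 2) ≤ M →
      Ecq f = Ecrit Wc →
      Real.sqrt (∫ x : E3, gradSqC (modG f θ μ) x) ≤ δ₀ →
      (∫ x : E3, ∑ j, pdR j (fun y => (modG f θ μ y).im) x
          * pdR j (fun y => Real.sqrt μ * W (μ • y)) x) = 0 →
      (∫ x : E3, ∑ j, pdR j (fun y => (modG f θ μ y).re) x
          * pdR j (fun y => Real.sqrt μ * W1 (μ • y)) x) = 0 →
      1 / (1 + μ) ≤ C * deltaF f := by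
  intro M _
  have hω := sphereArea_pos
  have hπ := Real.pi_pos
  have hK : 0 < ∫ x, gradSqC Wc x := by
    rw [integral_gradSqC_Wc]
    positivity
  refine ⟨√(Real.pi * sphereArea / 128), by positivity,
    1024 / sphereArea + 1 / ∫ x, gradSqC Wc x, by positivity, ?_⟩
  intro f θ μ hμ hr hf _ h4 h6 h2 _ hE hg _ _
  rw [Real.sqrt_le_sqrt_iff (by positivity)] at hg
  have hδ : deltaF f = |(∫ x, gradSqC Wc x) - ∫ x, gradSqC f x| := by
    simp only [deltaF, gradSqC_Wc]
  have hδ0 : 0 ≤ deltaF f := abs_nonneg _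
  rw [add_mul]
  have t1 : 0 ≤ 1024 / sphereArea * deltaF f := by positivity
  have t2 : 0 ≤ 1 / (∫ x, gradSqC Wc x) * deltaF f := by positivity
  rcases le_total (∫ x, gradSqC f x) (2 * ∫ x, gradSqC Wc x) with hN | hN
  · have hu := integral_norm_pow_four_le hr hf h4 h6 h2 hE hN
    have hl := le_integral_norm_pow_four hr hf h4 h6 h2 hμ hg
    have h1 : 1 / (1 + μ) ≤ 1 / μ := one_div_le_one_div_of_le hμ (by linarith)
    have h3 : 1 / μ = 128 / sphereArea * (sphereArea / (128 * μ)) := by field_simp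
    have h5 : 128 / sphereArea * (sphereArea / (128 * μ)) ≤
        128 / sphereArea * (8 * deltaF f) :=
      mul_le_mul_of_nonneg_left (hl.trans hu) (by positivity)
    have h7 : 128 / sphereArea * (8 * deltaF f) = 1024 / sphereArea * deltaF f := by ring
    linarith
  · have h1 : 1 / (1 + μ) ≤ 1 := by
      rw [div_le_one (by positivity)]; linarith
    have h3 : (∫ x, gradSqC Wc x) ≤ deltaF f := by
      rw [hδ, abs_sub_comm]
      exact le_trans (by linarith) (le_abs_self _)
    have h5 : 1 ≤ 1 / (∫ x, gradSqC Wc x) * deltaF f := by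
      rw [one_div_mul_eq_div, le_div_iff₀ hK]; linarith
    linarith
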